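/- arXiv:math/0003108 — 2 statements merged into one kernel-verified Lean document; each statement's English description precedes it below -/
import Mathlib

section
/- Let Z = (α,β) ∈ aff(R) with Hamiltonian function Z̃(p,q) = αp + βe^q on R². For every smooth function g : R² → C: P¹(Z̃,g) = α ∂g/∂q − βe^q ∂g/∂p, and for every integer k ≥ 2, P^k(Z̃,g) = (−1)^k βe^q ∂^k g/∂p^k. -/
noncomputable section

open Complex

/-- The standard basis vectors of `ℝ²` in the coordinates `x = (x¹,x²) = (p,q)`. -/
def basisR2 : Fin 2 → ℝ × ℝ := ![(1, 0), (0, 1)]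

/-- The partial derivative of `f : ℝ² → ℂ` in the `i`-th coordinate direction. -/
def pd2 (i : Fin 2) (f : ℝ × ℝ → ℂ) : ℝ × ℝ → ℂ :=
  fun x => fderiv ℝ f x (basisR2 i)

/-- Iterated partial derivative `∂^r f / ∂x^{i₁}⋯∂x^{i_r}`. -/
def pd2Multi : (r : ℕ) → (Fin r → Fin 2) → (ℝ × ℝ → ℂ) → (ℝ × ℝ → ℂ)
  | 0, _, f => f
  | r + 1, idx, f => pd2Multi r (fun k => idx k.succ) (pd2 (idx 0) f)

/-- The matrix `Λ` with `Λ¹² = 1`, `Λ²¹ = -1`, `Λ¹¹ = Λ²² = 0`. -/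
def lambda2 : Fin 2 → Fin 2 → ℂ :=
  fun i j => !![0, 1; -1, 0] i j

/-- `P^r(u,v) = Σ Λ^{i₁j₁}⋯Λ^{i_rj_r} ∂_{i₁⋯i_r}u ∂_{j₁⋯j_r}v`. -/
def P2 (r : ℕ) (u v : ℝ × ℝ → ℂ) : ℝ × ℝ → ℂ := fun x =>
  ∑ i : Fin r → Fin 2, ∑ j : Fin r → Fin 2,
    (∏ k : Fin r, lambda2 (i k) (j k)) * pd2Multi r i u x * pd2Multi r j v x

/-- The Hamiltonian function `Z̃(p,q) = αp + βe^q` of `Z = (α,β) ∈ aff(ℝ)`,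
viewed as complex valued. -/
def affHam (Z : ℝ × ℝ) : ℝ × ℝ → ℂ := fun x =>
  (Z.1 : ℂ) * (x.1 : ℂ) + (Z.2 : ℂ) * (Real.exp x.2 : ℂ)

theorem P2_succ (r : ℕ) (u v : ℝ × ℝ → ℂ) (x : ℝ × ℝ) :
    P2 (r + 1) u v x = P2 r (pd2 0 u) (pd2 1 v) x - P2 r (pd2 1 u) (pd2 0 v) x := by
  simp only [P2]
  rw [← (Fin.consEquiv fun _ : Fin (r + 1) => Fin 2).sum_comp, Fintype.sum_prod_type]
  simp_rw [← (Fin.consEquiv fun _ : Fin (r + 1) => Fin 2).sum_comp, Fintype.sum_prod_type]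
  simp [Fin.prod_univ_succ, Fin.sum_univ_two, pd2Multi, lambda2, Fin.consEquiv, sub_eq_add_neg]

theorem pd2_const (i : Fin 2) (c : ℂ) : pd2 i (fun _ => c) = fun _ => 0 := by
  funext x
  simp [pd2]

theorem pd2Multi_zero (r : ℕ) (i : Fin r → Fin 2) :
    pd2Multi r i (fun _ => 0) = fun _ => 0 := by
  induction r with
  | zero => rfl
  | succ r ih => rw [pd2Multi, pd2_const, ih]

theorem P2_zero_left (r : ℕ) (v : ℝ × ℝ → ℂ) (x : ℝ × ℝ) : P2 r (fun _ => 0) v x = 0 := by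
  simp [P2, pd2Multi_zero]

theorem P2_succ_const_left (r : ℕ) (c : ℂ) (v : ℝ × ℝ → ℂ) (x : ℝ × ℝ) :
    P2 (r + 1) (fun _ => c) v x = 0 := by
  simp [P2_succ, pd2_const, P2_zero_left]

theorem P2_zero_order (u v : ℝ × ℝ → ℂ) (x : ℝ × ℝ) : P2 0 u v x = u x * v x := by
  simp [P2, pd2Multi]

theorem hasFDerivAt_affHam (Z x : ℝ × ℝ) :
    HasFDerivAt (affHam Z)
      ((Z.1 : ℂ) • ofRealCLM.comp (ContinuousLinearMap.fst ℝ ℝ ℝ) +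
        (Z.2 : ℂ) • ofRealCLM.comp (Real.exp x.2 • ContinuousLinearMap.snd ℝ ℝ ℝ)) x :=
  ((ofRealCLM.hasFDerivAt.comp x hasFDerivAt_fst).const_mul (Z.1 : ℂ)).add
    ((ofRealCLM.hasFDerivAt.comp x hasFDerivAt_snd.exp).const_mul (Z.2 : ℂ))

theorem pd2_zero_affHam (Z : ℝ × ℝ) : pd2 0 (affHam Z) = fun _ => (Z.1 : ℂ) := by
  funext x
  simp [pd2, (hasFDerivAt_affHam Z x).fderiv, basisR2]

theorem pd2_one_affHam (Z : ℝ × ℝ) : pd2 1 (affHam Z) = affHam (0, Z.2) := by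
  funext x
  simp [pd2, (hasFDerivAt_affHam Z x).fderiv, basisR2, affHam]

theorem P2_affHam_zero_fst (k : ℕ) (b : ℝ) (v : ℝ × ℝ → ℂ) (x : ℝ × ℝ) :
    P2 k (affHam (0, b)) v x =
      (-1 : ℂ) ^ k * (b : ℂ) * (Real.exp x.2 : ℂ) * pd2Multi k (fun _ => 0) v x := by
  induction k generalizing v with
  | zero => simp [P2_zero_order, affHam, pd2Multi]
  | succ k ih =>
    rw [P2_succ, pd2_zero_affHam, pd2_one_affHam, ih, ofReal_zero, P2_zero_left, pd2Multi]
    ring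

/-- For `Z = (α,β) ∈ aff(ℝ)` with `Z̃(p,q) = αp + βe^q` and any smooth `g : ℝ² → ℂ`:
`P¹(Z̃,g) = α ∂g/∂q - βe^q ∂g/∂p`, and for every `k ≥ 2`,
`P^k(Z̃,g) = (-1)^k βe^q ∂^k g/∂p^k`. -/
theorem P_of_affine_hamiltonian (Z : ℝ × ℝ) (g : ℝ × ℝ → ℂ) (hg : ContDiff ℝ (⊤ : ℕ∞) g) :
    (∀ x : ℝ × ℝ,
      P2 1 (affHam Z) g x =
        (Z.1 : ℂ) * pd2 1 g x - (Z.2 : ℂ) * (Real.exp x.2 : ℂ) * pd2 0 g x) ∧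
    (∀ k : ℕ, 2 ≤ k → ∀ x : ℝ × ℝ,
      P2 k (affHam Z) g x =
        (-1 : ℂ) ^ k * (Z.2 : ℂ) * (Real.exp x.2 : ℂ) *
          pd2Multi k (fun _ => 0) g x) := by
  refine ⟨fun x => ?_, fun k hk x => ?_⟩
  · rw [P2_succ, pd2_zero_affHam, pd2_one_affHam, P2_zero_order, P2_zero_order]
    simp [affHam]
  · obtain ⟨k, rfl⟩ := Nat.exists_eq_add_of_le' hk
    rw [P2_succ, pd2_zero_affHam, pd2_one_affHam, P2_succ_const_left, P2_affHam_zero_fst,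
      pd2Multi.eq_2 g (k + 1)]
    ring

end
end

section
/- Let A = (α,β) ∈ aff(C) with Hamiltonian function Ã(z,w) = (1/2)(αz + βe^w + ᾱz̄ + β̄e^{w̄}), and let ℓ_A(g) := iÃ ⋆ g denote left Moyal multiplication by iÃ. Then for every compactly supported smooth function f on C × H_k (H_k = {w : 2kπ < Im w < 2kπ+2π}), the series defining ℓ_A(F_z⁻¹(f)) converges, and the conjugated operator ℓ̂_A := F_z ∘ ℓ_A ∘ F_z⁻¹ satisfies ℓ̂_A(f) = α((1/2)∂_w − ∂_ξ̄)f + ᾱ((1/2)∂_w̄ − ∂_ξ)f + (i/2)(β e^{w − ξ̄/2} + β̄ e^{w̄ − ξ/2}) f. -/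
noncomputable section

open Complex MeasureTheory

/-- `ℝ⁴` with coordinates `(x¹,x²,x³,x⁴) = (p₁,q₁,p₂,q₂)`. -/
abbrev R4 := Fin 4 → ℝ

/-- The complex coordinate `z = p₁ + ip₂` of a point of `ℝ⁴`. -/
def zOf (x : R4) : ℂ := (x 0 : ℂ) + I * (x 2 : ℂ)

/-- The complex coordinate `w = q₁ + iq₂` of a point of `ℝ⁴`. -/
def wOf (x : R4) : ℂ := (x 1 : ℂ) + I * (x 3 : ℂ)

/-- The partial derivative of `f : ℝ⁴ → ℂ` in the `i`-th coordinate direction. -/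
def pd4 (i : Fin 4) (f : R4 → ℂ) : R4 → ℂ :=
  fun x => fderiv ℝ f x (Pi.single i 1)

/-- Iterated partial derivative `∂^r f / ∂x^{i₁}⋯∂x^{i_r}`. -/
def pd4Multi : (r : ℕ) → (Fin r → Fin 4) → (R4 → ℂ) → (R4 → ℂ)
  | 0, _, f => f
  | r + 1, idx, f => pd4Multi r (fun k => idx k.succ) (pd4 (idx 0) f)

/-- The matrix `Λ` with nonzero entries `Λ¹² = 1`, `Λ²¹ = -1`, `Λ³⁴ = -1`,
`Λ⁴³ = 1`. -/
def lambda4 : Fin 4 → Fin 4 → ℂ :=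
  fun i j => !![0, 1, 0, 0; -1, 0, 0, 0; 0, 0, 0, -1; 0, 0, 1, 0] i j

/-- `P^r(u,v) = Σ Λ^{i₁j₁}⋯Λ^{i_rj_r} ∂_{i₁⋯i_r}u ∂_{j₁⋯j_r}v`. -/
def P4 (r : ℕ) (u v : R4 → ℂ) : R4 → ℂ := fun x =>
  ∑ i : Fin r → Fin 4, ∑ j : Fin r → Fin 4,
    (∏ k : Fin r, lambda4 (i k) (j k)) * pd4Multi r i u x * pd4Multi r j v x

/-- The Moyal ⋆-product `u ⋆ v = uv + Σ_{r≥1} (1/r!)(1/(2i))^r P^r(u,v)`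
(the `r = 0` term of the series is exactly `uv`). -/
def moyal4 (u v : R4 → ℂ) : R4 → ℂ := fun x =>
  ∑' r : ℕ, ((r.factorial : ℂ))⁻¹ * (1 / (2 * I)) ^ r * P4 r u v x

/-- The Hamiltonian function `Ã(z,w) = (1/2)(αz + βe^w + ᾱz̄ + β̄e^{w̄})` of
`A = (α,β) ∈ aff(ℂ)`, in the coordinates `(p₁,q₁,p₂,q₂)` of `ℝ⁴`. -/
def affHamC4 (A : ℂ × ℂ) : R4 → ℂ := fun x =>
  (1 / 2) * (A.1 * zOf x + A.2 * Complex.exp (wOf x) +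
    (starRingEnd ℂ) A.1 * (starRingEnd ℂ) (zOf x) +
    (starRingEnd ℂ) A.2 * Complex.exp ((starRingEnd ℂ) (wOf x)))

/-- View a function of the complex coordinates `(z,w)` as a function on `ℝ⁴`. -/
def toCoords (h : ℂ × ℂ → ℂ) : R4 → ℂ := fun x => h (zOf x, wOf x)

/-- View a function on `ℝ⁴` as a function of the complex coordinates `(z,w)`. -/
def ofCoords (u : R4 → ℂ) : ℂ × ℂ → ℂ := fun p =>
  u ![p.1.re, p.2.re, p.1.im, p.2.im]

/-- The partial Fourier transform in `z = p₁ + ip₂`: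
`F_z(f)(ξ,w) = (1/(2π)) ∫_{ℝ²} e^{-i Re(ξ z̄)} f(z,w) dp₁dp₂`. -/
def Fz (f : ℂ × ℂ → ℂ) : ℂ × ℂ → ℂ := fun p =>
  (1 / (2 * Real.pi) : ℝ) •
    ∫ t : ℝ × ℝ,
      Complex.exp (-(Complex.I * ((p.1 * (starRingEnd ℂ) ((t.1 : ℂ) + Complex.I * (t.2 : ℂ))).re : ℂ))) *
        f ((t.1 : ℂ) + Complex.I * (t.2 : ℂ), p.2)

/-- The inverse partial Fourier transform:
`F_z⁻¹(f)(z,w) = (1/(2π)) ∫_{ℝ²} e^{i Re(ξ z̄)} f(ξ,w) dξ₁dξ₂`. -/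
def FzInv (f : ℂ × ℂ → ℂ) : ℂ × ℂ → ℂ := fun p =>
  (1 / (2 * Real.pi) : ℝ) •
    ∫ t : ℝ × ℝ,
      Complex.exp (Complex.I * (((((t.1 : ℂ) + Complex.I * (t.2 : ℂ)) * (starRingEnd ℂ) p.1).re : ℂ))) *
        f ((t.1 : ℂ) + Complex.I * (t.2 : ℂ), p.2)

/-- The strip `H_k = {w ∈ ℂ : 2kπ < Im w < 2kπ + 2π}`. -/
def stripH (k : ℤ) : Set ℂ :=
  {w | 2 * (k : ℝ) * Real.pi < w.im ∧ w.im < 2 * (k : ℝ) * Real.pi + 2 * Real.pi}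

/-- Wirtinger derivative `∂_ξ` in the first complex variable. -/
def wdXi (f : ℂ × ℂ → ℂ) : ℂ × ℂ → ℂ := fun p =>
  (1 / 2) * (fderiv ℝ f p (1, 0) - I * fderiv ℝ f p (I, 0))

/-- Wirtinger derivative `∂_ξ̄` in the first complex variable. -/
def wdXibar (f : ℂ × ℂ → ℂ) : ℂ × ℂ → ℂ := fun p =>
  (1 / 2) * (fderiv ℝ f p (1, 0) + I * fderiv ℝ f p (I, 0))

/-- Wirtinger derivative `∂_w` in the second complex variable. -/
def wdw (f : ℂ × ℂ → ℂ) : ℂ × ℂ → ℂ := fun p =>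
  (1 / 2) * (fderiv ℝ f p (0, 1) - I * fderiv ℝ f p (0, I))

/-- Wirtinger derivative `∂_w̄` in the second complex variable. -/
def wdwbar (f : ℂ × ℂ → ℂ) : ℂ × ℂ → ℂ := fun p =>
  (1 / 2) * (fderiv ℝ f p (0, 1) + I * fderiv ℝ f p (0, I))

/-- Differentiation under the integral sign for a `C¹` integrand whose support in the integration
variable stays in a fixed compact set. -/
theorem hasFDerivAt_integral_of_contDiff_of_compact {H α E : Type*}
    [NormedAddCommGroup H] [NormedSpace ℝ H] [ProperSpace H]
    [NormedAddCommGroup α] [NormedSpace ℝ α] [MeasurableSpace α] [BorelSpace α]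
    [SecondCountableTopology α]
    [NormedAddCommGroup E] [NormedSpace ℝ E]
    {μ : Measure α} [IsFiniteMeasureOnCompacts μ]
    {F : H × α → E} (hF : ContDiff ℝ 1 F) {K : Set α} (hK : IsCompact K)
    (hFK : ∀ x, ∀ a ∉ K, F (x, a) = 0) (x₀ : H) :
    Integrable (fun a => fderiv ℝ (fun x => F (x, a)) x₀) μ ∧
    HasFDerivAt (fun x => ∫ a, F (x, a) ∂μ)
      (∫ a, fderiv ℝ (fun x => F (x, a)) x₀ ∂μ) x₀ := by
  have hd : ∀ x a, HasFDerivAt (fun y => F (y, a))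
      ((fderiv ℝ F (x, a)).comp (ContinuousLinearMap.inl ℝ H α)) x := fun x a =>
    ((hF.differentiable one_ne_zero (x, a)).hasFDerivAt).comp x
      (hasFDerivAt_prodMk_left x a)
  have hcont : Continuous fun p : H × α => fderiv ℝ (fun y => F (y, p.2)) p.1 := by
    have : (fun p : H × α => fderiv ℝ (fun y => F (y, p.2)) p.1) =
        fun p => (fderiv ℝ F p).comp (ContinuousLinearMap.inl ℝ H α) := by
      funext p
      exact (hd p.1 p.2).fderiv
    rw [this]
    exact (hF.continuous_fderiv one_ne_zero).clm_comp continuous_const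
  have hzero : ∀ x, ∀ a ∉ K, fderiv ℝ (fun y => F (y, a)) x = 0 := by
    intro x a ha
    have : (fun y => F (y, a)) = fun _ => 0 := funext fun y => hFK y a ha
    rw [this]
    simp
  obtain ⟨C, hC⟩ := ((isCompact_closedBall x₀ 1).prod hK).exists_bound_of_continuousOn
    hcont.continuousOn
  have hF'int : Integrable (fun a => fderiv ℝ (fun x => F (x, a)) x₀) μ :=
    (hcont.comp (Continuous.prodMk_right x₀)).integrable_of_hasCompactSupport
      (HasCompactSupport.intro hK (hzero x₀))
  refine ⟨hF'int, ?_⟩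
  refine hasFDerivAt_integral_of_dominated_of_fderiv_le
    (F := fun x a => F (x, a)) (F' := fun x a => fderiv ℝ (fun y => F (y, a)) x)
    (bound := K.indicator fun _ => C) (Metric.closedBall_mem_nhds x₀ one_pos) ?_ ?_
    hF'int.aestronglyMeasurable ?_ ?_ ?_
  · exact Filter.Eventually.of_forall fun x =>
      (hF.continuous.comp (Continuous.prodMk_right x)).aestronglyMeasurable
  · exact (hF.continuous.comp (Continuous.prodMk_right x₀)).integrable_of_hasCompactSupport
      (HasCompactSupport.intro hK (hFK x₀))
  · refine Filter.Eventually.of_forall fun a x hx => ?_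
    by_cases ha : a ∈ K
    · simpa [ha] using hC (x, a) ⟨hx, ha⟩
    · simp [ha, hzero x a ha]
  · exact (integrable_indicator_iff hK.measurableSet).2
      (integrableOn_const hK.measure_ne_top)
  · exact Filter.Eventually.of_forall fun a x _ => (hd x a).differentiableAt.hasFDerivAt

theorem integral_prod_eq_integral_complex (h : ℂ → ℂ) :
    ∫ t : ℝ × ℝ, h ((t.1 : ℂ) + I * (t.2 : ℂ)) = ∫ ξ : ℂ, h ξ := by
  rw [← (Complex.volume_preserving_equiv_real_prod.symm).integral_comp
    Complex.measurableEquivRealProd.symm.measurableEmbedding]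
  refine integral_congr_ae (Filter.Eventually.of_forall fun t => ?_)
  simp only
  congr 1
  apply Complex.ext <;> simp [Complex.measurableEquivRealProd]

/-- The inverse partial Fourier transform in the real coordinates of `ℝ⁴`. -/
def invFourier (g : ℂ × ℂ → ℂ) : R4 → ℂ := fun x =>
  (1 / (2 * Real.pi) : ℂ) *
    ∫ ξ : ℂ, cexp (I * (ξ.re * x 0 + ξ.im * x 2)) * g (ξ, wOf x)

theorem toCoords_FzInv (g : ℂ × ℂ → ℂ) : toCoords (FzInv g) = invFourier g := by
  funext x
  simp only [toCoords, FzInv, invFourier]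
  rw [integral_prod_eq_integral_complex
    (fun ξ => cexp (I * (((ξ * (starRingEnd ℂ) (zOf x)).re : ℝ) : ℂ)) * g (ξ, wOf x))]
  rw [Complex.real_smul]
  push_cast
  congr 3
  funext ξ
  simp [zOf]

/-- Smooth compactly supported functions on `ℂ × ℂ`. -/
structure IsTest (g : ℂ × ℂ → ℂ) : Prop where
  contDiff : ContDiff ℝ (⊤ : ℕ∞) g
  hasCompactSupport : HasCompactSupport g

namespace IsTest

variable {g h : ℂ × ℂ → ℂ}

theorem add (hg : IsTest g) (hh : IsTest h) : IsTest (fun p => g p + h p) :=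
  ⟨hg.contDiff.add hh.contDiff, hg.hasCompactSupport.add hh.hasCompactSupport⟩

theorem smooth_mul (hg : IsTest g) {φ : ℂ × ℂ → ℂ} (hφ : ContDiff ℝ (⊤ : ℕ∞) φ) :
    IsTest (fun p => φ p * g p) :=
  ⟨hφ.mul hg.contDiff, hg.hasCompactSupport.mul_left⟩

theorem const_mul (hg : IsTest g) (c : ℂ) : IsTest (fun p => c * g p) :=
  hg.smooth_mul contDiff_const

theorem fderiv_apply (hg : IsTest g) (v : ℂ × ℂ) : IsTest (fun p => fderiv ℝ g p v) :=
  ⟨(hg.contDiff.fderiv_right (m := (⊤ : ℕ∞)) (by simp)).clm_apply contDiff_const,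
    hg.hasCompactSupport.fderiv_apply ℝ v⟩

theorem exists_compact (hg : IsTest g) :
    ∃ K : Set ℂ, IsCompact K ∧ ∀ ξ ∉ K, ∀ w, g (ξ, w) = 0 := by
  refine ⟨Prod.fst '' tsupport g, hg.hasCompactSupport.isCompact.image continuous_fst, ?_⟩
  intro ξ hξ w
  by_contra hne
  exact hξ ⟨(ξ, w), subset_tsupport g hne, rfl⟩

theorem slice_contDiff (hg : IsTest g) (w : ℂ) : ContDiff ℝ (⊤ : ℕ∞) (fun ξ => g (ξ, w)) :=
  hg.contDiff.comp (contDiff_id.prodMk contDiff_const)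

theorem slice_hasCompactSupport (hg : IsTest g) (w : ℂ) :
    HasCompactSupport (fun ξ => g (ξ, w)) := by
  obtain ⟨K, hK, h0⟩ := hg.exists_compact
  exact HasCompactSupport.intro hK fun ξ hξ => h0 ξ hξ w

theorem integrable_mul (hg : IsTest g) {e : ℂ → ℂ} (he : Continuous e) (w : ℂ) :
    Integrable (fun ξ => e ξ * g (ξ, w)) :=
  (he.mul (hg.slice_contDiff w).continuous).integrable_of_hasCompactSupport
    (hg.slice_hasCompactSupport w).mul_left

end IsTest

theorem continuous_phase (x : R4) :
    Continuous fun ξ : ℂ => cexp (I * (ξ.re * x 0 + ξ.im * x 2)) := by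
  fun_prop

theorem invFourier_add {g h : ℂ × ℂ → ℂ} (hg : IsTest g) (hh : IsTest h) (x : R4) :
    invFourier (fun p => g p + h p) x = invFourier g x + invFourier h x := by
  simp only [invFourier]
  rw [← mul_add, ← integral_add (hg.integrable_mul (continuous_phase x) _)
    (hh.integrable_mul (continuous_phase x) _)]
  simp only [← mul_add]

theorem invFourier_mul_snd (c : ℂ → ℂ) (g : ℂ × ℂ → ℂ) (x : R4) :
    invFourier (fun p => c p.2 * g p) x = c (wOf x) * invFourier g x := by
  simp only [invFourier, mul_left_comm _ (c _)]
  rw [integral_const_mul]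
  ring

theorem invFourier_const_mul (c : ℂ) (g : ℂ × ℂ → ℂ) (x : R4) :
    invFourier (fun p => c * g p) x = c * invFourier g x :=
  invFourier_mul_snd (fun _ => c) g x

/-- The operator on the Fourier side that corresponds to `∂/∂xⁱ`. -/
def symbolOp (i : Fin 4) (g : ℂ × ℂ → ℂ) : ℂ × ℂ → ℂ := fun p =>
  I * (p.1.re * (Pi.single i 1 : R4) 0 + p.1.im * (Pi.single i 1 : R4) 2) * g p +
    fderiv ℝ g p (0, wOf (Pi.single i 1))

theorem contDiff_re_fst : ContDiff ℝ (⊤ : ℕ∞) fun p : ℂ × ℂ => (p.1.re : ℂ) :=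
  (Complex.ofRealCLM.comp (Complex.reCLM.comp (ContinuousLinearMap.fst ℝ ℂ ℂ))).contDiff

theorem contDiff_im_fst : ContDiff ℝ (⊤ : ℕ∞) fun p : ℂ × ℂ => (p.1.im : ℂ) :=
  (Complex.ofRealCLM.comp (Complex.imCLM.comp (ContinuousLinearMap.fst ℝ ℂ ℂ))).contDiff

theorem contDiff_conj_fst :
    ContDiff ℝ (⊤ : ℕ∞) fun p : ℂ × ℂ => (starRingEnd ℂ) p.1 :=
  (Complex.conjCLE.toContinuousLinearMap.comp (ContinuousLinearMap.fst ℝ ℂ ℂ)).contDiff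

theorem contDiff_conj_snd :
    ContDiff ℝ (⊤ : ℕ∞) fun p : ℂ × ℂ => (starRingEnd ℂ) p.2 :=
  (Complex.conjCLE.toContinuousLinearMap.comp (ContinuousLinearMap.snd ℝ ℂ ℂ)).contDiff

theorem IsTest.symbolOp {g : ℂ × ℂ → ℂ} (hg : IsTest g) (i : Fin 4) :
    IsTest (symbolOp i g) := by
  refine (hg.smooth_mul ?_).add (hg.fderiv_apply _)
  exact contDiff_const.mul
    ((contDiff_re_fst.mul contDiff_const).add (contDiff_im_fst.mul contDiff_const))

/-- The coordinate `w` as a continuous linear map. -/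
def wCLM : R4 →L[ℝ] ℂ :=
  Complex.ofRealCLM.comp (ContinuousLinearMap.proj 1) +
    I • Complex.ofRealCLM.comp (ContinuousLinearMap.proj 3)

theorem wCLM_apply (x : R4) : wCLM x = wOf x := by
  simp [wCLM, wOf]

/-- The coordinate `z` as a continuous linear map. -/
def zCLM : R4 →L[ℝ] ℂ :=
  Complex.ofRealCLM.comp (ContinuousLinearMap.proj 0) +
    I • Complex.ofRealCLM.comp (ContinuousLinearMap.proj 2)

theorem zCLM_apply (x : R4) : zCLM x = zOf x := by
  simp [zCLM, zOf]

theorem hasFDerivAt_wOf (x : R4) : HasFDerivAt wOf wCLM x :=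
  (wCLM.hasFDerivAt (x := x)).congr_of_eventuallyEq
    (Filter.Eventually.of_forall fun y => (wCLM_apply y).symm)

theorem hasFDerivAt_zOf (x : R4) : HasFDerivAt zOf zCLM x :=
  (zCLM.hasFDerivAt (x := x)).congr_of_eventuallyEq
    (Filter.Eventually.of_forall fun y => (zCLM_apply y).symm)

theorem contDiff_wOf : ContDiff ℝ (⊤ : ℕ∞) wOf := by
  rw [← funext wCLM_apply]
  exact wCLM.contDiff

/-- The linear form `x ↦ ξ₁ p₁ + ξ₂ p₂`. -/
def phaseCLM (ξ : ℂ) : R4 →L[ℝ] ℂ :=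
  (ξ.re : ℂ) • Complex.ofRealCLM.comp (ContinuousLinearMap.proj 0) +
    (ξ.im : ℂ) • Complex.ofRealCLM.comp (ContinuousLinearMap.proj 2)

theorem phaseCLM_apply (ξ : ℂ) (x : R4) : phaseCLM ξ x = ξ.re * x 0 + ξ.im * x 2 := by
  simp [phaseCLM]

theorem contDiff_invFourier_integrand {g : ℂ × ℂ → ℂ} (hg : IsTest g) :
    ContDiff ℝ 1 fun p : R4 × ℂ =>
      cexp (I * (p.2.re * p.1 0 + p.2.im * p.1 2)) * g (p.2, wOf p.1) := by
  have hre : ContDiff ℝ 1 fun p : R4 × ℂ => (p.2.re : ℂ) :=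
    (Complex.ofRealCLM.comp (Complex.reCLM.comp (ContinuousLinearMap.snd ℝ R4 ℂ))).contDiff
  have him : ContDiff ℝ 1 fun p : R4 × ℂ => (p.2.im : ℂ) :=
    (Complex.ofRealCLM.comp (Complex.imCLM.comp (ContinuousLinearMap.snd ℝ R4 ℂ))).contDiff
  have hx : ∀ i : Fin 4, ContDiff ℝ 1 fun p : R4 × ℂ => (p.1 i : ℂ) := fun i =>
    (Complex.ofRealCLM.comp
      ((ContinuousLinearMap.proj i).comp (ContinuousLinearMap.fst ℝ R4 ℂ))).contDiff
  refine ContDiff.mul ?_ ?_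
  · exact (contDiff_const.mul ((hre.mul (hx 0)).add (him.mul (hx 2)))).cexp
  · exact (hg.contDiff.of_le (by exact_mod_cast le_top)).comp
      (contDiff_snd.prodMk ((contDiff_wOf.of_le (by exact_mod_cast le_top)).comp contDiff_fst))

theorem pd4_invFourier {g : ℂ × ℂ → ℂ} (hg : IsTest g) (i : Fin 4) :
    pd4 i (invFourier g) = invFourier (symbolOp i g) := by
  funext x
  obtain ⟨K, hK, h0⟩ := hg.exists_compact
  obtain ⟨hint, hder⟩ := hasFDerivAt_integral_of_contDiff_of_compact (μ := (volume : Measure ℂ))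
    (contDiff_invFourier_integrand hg) hK (fun y ξ hξ => by simp [h0 ξ hξ]) x
  have hder' := hder.const_mul (1 / (2 * Real.pi) : ℂ)
  have hpd : pd4 i (invFourier g) x = _ := congrArg (fun L => L (Pi.single i 1)) hder'.fderiv
  rw [hpd]
  simp only [invFourier, _root_.smul_apply, smul_eq_mul]
  rw [ContinuousLinearMap.integral_apply hint]
  congr 2
  funext ξ
  have hphase : HasFDerivAt (fun y : R4 => cexp (I * (ξ.re * y 0 + ξ.im * y 2)))
      (cexp (I * (ξ.re * x 0 + ξ.im * x 2)) • (I • phaseCLM ξ)) x := by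
    have h1 : HasFDerivAt (fun y : R4 => I * (ξ.re * y 0 + ξ.im * y 2)) (I • phaseCLM ξ) x :=
      ((phaseCLM ξ).hasFDerivAt.const_mul I).congr_of_eventuallyEq
        (Filter.Eventually.of_forall fun y => by simp only [phaseCLM_apply])
    exact h1.cexp
  have hgd : HasFDerivAt (fun y : R4 => g (ξ, wOf y))
      ((fderiv ℝ g (ξ, wOf x)).comp ((0 : R4 →L[ℝ] ℂ).prod wCLM)) x :=
    HasFDerivAt.comp x ((hg.contDiff.differentiable (by simp)) (ξ, wOf x)).hasFDerivAt
      ((hasFDerivAt_const ξ x).prodMk (hasFDerivAt_wOf x))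
  refine (congrArg (fun L => L (Pi.single i 1)) (hphase.mul hgd).fderiv).trans ?_
  simp only [_root_.add_apply, _root_.smul_apply,
    ContinuousLinearMap.comp_apply, ContinuousLinearMap.prod_apply, wCLM_apply, phaseCLM_apply,
    symbolOp, smul_eq_mul, _root_.zero_apply]
  ring

theorem symbolOp_zero (g : ℂ × ℂ → ℂ) : symbolOp 0 g = fun p => I * p.1.re * g p := by
  funext p
  simp [symbolOp, wOf, Prod.mk_zero_zero]

theorem symbolOp_one (g : ℂ × ℂ → ℂ) : symbolOp 1 g = fun p => fderiv ℝ g p (0, 1) := by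
  funext p
  simp [symbolOp, wOf]

theorem symbolOp_two (g : ℂ × ℂ → ℂ) : symbolOp 2 g = fun p => I * p.1.im * g p := by
  funext p
  simp [symbolOp, wOf, Prod.mk_zero_zero]

theorem symbolOp_three (g : ℂ × ℂ → ℂ) : symbolOp 3 g = fun p => fderiv ℝ g p (0, I) := by
  funext p
  simp [symbolOp, wOf]

/-- Linear functions of `z, z̄` plus exponentials of `w, w̄`: a family closed under partial
derivatives which contains the Hamiltonian functions of `aff(ℂ)`. -/
def hamFamily (a a' b b' c : ℂ) : R4 → ℂ := fun x =>
  a * zOf x + a' * (starRingEnd ℂ) (zOf x) + b * cexp (wOf x) +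
    b' * cexp ((starRingEnd ℂ) (wOf x)) + c

theorem pd4_hamFamily (a a' b b' c : ℂ) (i : Fin 4) :
    pd4 i (hamFamily a a' b b' c) =
      hamFamily 0 0 (b * wOf (Pi.single i 1)) (b' * (starRingEnd ℂ) (wOf (Pi.single i 1)))
        (a * zOf (Pi.single i 1) + a' * (starRingEnd ℂ) (zOf (Pi.single i 1))) := by
  funext x
  have hz := hasFDerivAt_zOf x
  have hw := hasFDerivAt_wOf x
  have hzc := Complex.conjCLE.toContinuousLinearMap.hasFDerivAt.comp x hz
  have hwc := Complex.conjCLE.toContinuousLinearMap.hasFDerivAt.comp x hw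
  have h := ((((hz.const_mul a).add (hzc.const_mul a')).add (hw.cexp.const_mul b)).add
    (hwc.cexp.const_mul b')).add_const c
  refine (congrArg (fun L => L (Pi.single i 1)) h.fderiv).trans ?_
  simp [hamFamily, zCLM_apply, wCLM_apply]
  ring

theorem P4_zero (u v : R4 → ℂ) (x : R4) : P4 0 u v x = u x * v x := by
  simp [P4, pd4Multi]

theorem P4_succ (r : ℕ) (u v : R4 → ℂ) (x : R4) :
    P4 (r + 1) u v x =
      P4 r (pd4 0 u) (pd4 1 v) x - P4 r (pd4 1 u) (pd4 0 v) x -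
        P4 r (pd4 2 u) (pd4 3 v) x + P4 r (pd4 3 u) (pd4 2 v) x := by
  have key : P4 (r + 1) u v x =
      ∑ a : Fin 4, ∑ b : Fin 4, lambda4 a b * P4 r (pd4 a u) (pd4 b v) x := by
    simp only [P4]
    rw [← (Fin.consEquiv fun _ : Fin (r + 1) => Fin 4).sum_comp, Fintype.sum_prod_type]
    refine Finset.sum_congr rfl fun a _ => ?_
    simp only [Finset.mul_sum]
    conv_rhs => rw [Finset.sum_comm]
    refine Finset.sum_congr rfl fun i _ => ?_
    rw [← (Fin.consEquiv fun _ : Fin (r + 1) => Fin 4).sum_comp, Fintype.sum_prod_type]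
    refine Finset.sum_congr rfl fun b _ => Finset.sum_congr rfl fun j _ => ?_
    simp [Fin.consEquiv, Fin.prod_univ_succ, pd4Multi]
    ring
  rw [key]
  simp [Fin.sum_univ_four, lambda4]
  ring

theorem P4_exp_invFourier (r : ℕ) {g : ℂ × ℂ → ℂ} (hg : IsTest g) (b b' c : ℂ) (x : R4) :
    P4 r (hamFamily 0 0 b b' c) (invFourier g) x =
      b * cexp (wOf x) * invFourier (fun p => (-(I * (starRingEnd ℂ) p.1)) ^ r * g p) x +
        b' * cexp ((starRingEnd ℂ) (wOf x)) * invFourier (fun p => (-(I * p.1)) ^ r * g p) x +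
        if r = 0 then c * invFourier g x else 0 := by
  induction r generalizing g b b' c with
  | zero => simp [P4_zero, hamFamily]; ring
  | succ r ih =>
    have hpow : ∀ (h : ℂ × ℂ → ℂ), IsTest h →
        IsTest (fun p => (-(I * (starRingEnd ℂ) p.1)) ^ r * h p) ∧
        IsTest (fun p => (-(I * p.1)) ^ r * h p) := fun h hh =>
      ⟨hh.smooth_mul ((contDiff_const.mul contDiff_conj_fst).neg.pow r),
        hh.smooth_mul ((contDiff_const.mul contDiff_fst).neg.pow r)⟩
    rw [P4_succ]
    simp only [pd4_hamFamily, pd4_invFourier hg]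
    rw [ih (hg.symbolOp 1), ih (hg.symbolOp 0), ih (hg.symbolOp 3), ih (hg.symbolOp 2)]
    have h1 : (fun p : ℂ × ℂ => (-(I * (starRingEnd ℂ) p.1)) ^ (r + 1) * g p) = fun p =>
        (-1 : ℂ) * ((-(I * (starRingEnd ℂ) p.1)) ^ r * symbolOp 0 g p) +
          I * ((-(I * (starRingEnd ℂ) p.1)) ^ r * symbolOp 2 g p) := by
      funext p
      have : (starRingEnd ℂ) p.1 = p.1.re - I * p.1.im := by
        apply Complex.ext <;> simp
      simp only [symbolOp_zero, symbolOp_two, pow_succ]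
      rw [this]
      ring
    have h2 : (fun p : ℂ × ℂ => (-(I * p.1)) ^ (r + 1) * g p) = fun p =>
        (-1 : ℂ) * ((-(I * p.1)) ^ r * symbolOp 0 g p) +
          (-I) * ((-(I * p.1)) ^ r * symbolOp 2 g p) := by
      funext p
      have : p.1 = p.1.re + I * p.1.im := by
        apply Complex.ext <;> simp
      simp only [symbolOp_zero, symbolOp_two, pow_succ]
      linear_combination -(-(I * p.1)) ^ r * g p * I * this
    rw [h1, h2, invFourier_add ((hpow _ (hg.symbolOp 0)).1.const_mul _)
        ((hpow _ (hg.symbolOp 2)).1.const_mul _),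
      invFourier_add ((hpow _ (hg.symbolOp 0)).2.const_mul _)
        ((hpow _ (hg.symbolOp 2)).2.const_mul _)]
    simp only [invFourier_const_mul]
    simp [wOf, zOf]
    ring

theorem P4_hamFamily_invFourier (r : ℕ) {g : ℂ × ℂ → ℂ} (hg : IsTest g) (a a' b b' : ℂ)
    (x : R4) :
    P4 r (hamFamily a a' b b' 0) (invFourier g) x =
      b * cexp (wOf x) * invFourier (fun p => (-(I * (starRingEnd ℂ) p.1)) ^ r * g p) x +
        b' * cexp ((starRingEnd ℂ) (wOf x)) * invFourier (fun p => (-(I * p.1)) ^ r * g p) x +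
        (if r = 0 then (a * zOf x + a' * (starRingEnd ℂ) (zOf x)) * invFourier g x else 0) +
        if r = 1 then (a + a') * invFourier (symbolOp 1 g) x -
          I * (a - a') * invFourier (symbolOp 3 g) x else 0 := by
  cases r with
  | zero => simp [P4_zero, hamFamily]; ring
  | succ r =>
    have hsplit : P4 (r + 1) (hamFamily a a' b b' 0) (invFourier g) x =
        P4 (r + 1) (hamFamily 0 0 b b' 0) (invFourier g) x +
          if r = 0 then (a + a') * invFourier (symbolOp 1 g) x -
            I * (a - a') * invFourier (symbolOp 3 g) x else 0 := by
      rw [P4_succ, P4_succ]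
      simp only [pd4_hamFamily, pd4_invFourier hg]
      rw [P4_exp_invFourier r (hg.symbolOp 1), P4_exp_invFourier r (hg.symbolOp 3),
        P4_exp_invFourier r (hg.symbolOp 1), P4_exp_invFourier r (hg.symbolOp 3)]
      by_cases hr : r = 0
      · simp [wOf, zOf, hr]
        ring
      · simp [wOf, zOf, hr]
    rw [hsplit, P4_exp_invFourier _ hg]
    simp

theorem hasSum_invFourier_exp {g : ℂ × ℂ → ℂ} (hg : IsTest g) {s : ℂ × ℂ → ℂ}
    (hs : ContDiff ℝ (⊤ : ℕ∞) s) (c : ℂ) (x : R4) :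
    HasSum (fun r : ℕ => (r.factorial : ℂ)⁻¹ * c ^ r * invFourier (fun p => s p ^ r * g p) x)
      (invFourier (fun p => cexp (c * s p) * g p) x) := by
  set e : ℂ → ℂ := fun ξ => cexp (I * (ξ.re * x 0 + ξ.im * x 2)) with he
  have hec : Continuous e := continuous_phase x
  have hsc : Continuous fun ξ => s (ξ, wOf x) := hs.continuous.comp (Continuous.prodMk_left _)
  have hgc : Continuous fun ξ => g (ξ, wOf x) := (hg.slice_contDiff _).continuous
  have hterm : ∀ r : ℕ, (r.factorial : ℂ)⁻¹ * c ^ r * invFourier (fun p => s p ^ r * g p) x =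
      (1 / (2 * Real.pi) : ℂ) * ∫ ξ, (r.factorial : ℂ)⁻¹ * (c * s (ξ, wOf x)) ^ r *
        (e ξ * g (ξ, wOf x)) := by
    intro r
    simp only [invFourier]
    rw [mul_left_comm, ← integral_const_mul]
    congr 2
    funext ξ
    rw [mul_pow]
    ring
  have hexp : ∀ y : ℂ, HasSum (fun r : ℕ => (r.factorial : ℂ)⁻¹ * y ^ r) (cexp y) := by
    intro y
    have := NormedSpace.exp_series_hasSum_exp' (𝕂 := ℂ) y
    rwa [← Complex.exp_eq_exp_ℂ] at this
  have hexpR : ∀ y : ℝ, HasSum (fun r : ℕ => (r.factorial : ℝ)⁻¹ * y ^ r) (Real.exp y) := by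
    intro y
    have := NormedSpace.exp_series_hasSum_exp' (𝕂 := ℝ) y
    rwa [← Real.exp_eq_exp_ℝ] at this
  simp only [hterm]
  refine HasSum.mul_left _ ?_
  refine hasSum_integral_of_dominated_convergence
    (fun r ξ => (r.factorial : ℝ)⁻¹ * ‖c * s (ξ, wOf x)‖ ^ r * ‖e ξ * g (ξ, wOf x)‖) ?_ ?_ ?_ ?_ ?_
  · intro r
    exact ((continuous_const.mul ((continuous_const.mul hsc).pow r)).mul
      (hec.mul hgc)).aestronglyMeasurable
  · intro r
    exact Filter.Eventually.of_forall fun ξ => by simp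
  · exact Filter.Eventually.of_forall fun ξ => ((hexpR _).mul_right _).summable
  · simp only [fun ξ => ((hexpR ‖c * s (ξ, wOf x)‖).mul_right ‖e ξ * g (ξ, wOf x)‖).tsum_eq]
    refine Continuous.integrable_of_hasCompactSupport
      ((Real.continuous_exp.comp (continuous_const.mul hsc).norm).mul (hec.mul hgc).norm) ?_
    exact ((hg.slice_hasCompactSupport (wOf x)).mul_left (f := e)).norm.mul_left
  · refine Filter.Eventually.of_forall fun ξ => ?_
    have := (hexp (c * s (ξ, wOf x))).mul_right (e ξ * g (ξ, wOf x))
    simpa only [he, mul_left_comm] using this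

theorem invFourier_fderiv_fst {g : ℂ × ℂ → ℂ} (hg : IsTest g) (v : ℂ) (x : R4) :
    invFourier (fun p => fderiv ℝ g p (v, 0)) x =
      -(I * (v.re * x 0 + v.im * x 2)) * invFourier g x := by
  set e : ℂ → ℂ := fun ξ => cexp (I * (ξ.re * x 0 + ξ.im * x 2)) with he
  have hec : Continuous e := continuous_phase x
  let L : ℂ →L[ℝ] ℂ := (x 0 : ℂ) • Complex.ofRealCLM.comp Complex.reCLM +
    (x 2 : ℂ) • Complex.ofRealCLM.comp Complex.imCLM
  have hL : ∀ ξ : ℂ, L ξ = ξ.re * x 0 + ξ.im * x 2 := fun ξ => by simp [L]; ring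
  have hed : ∀ ξ, HasFDerivAt e (e ξ • (I • L)) ξ := by
    intro ξ
    have h1 : HasFDerivAt (fun ζ : ℂ => I * (ζ.re * x 0 + ζ.im * x 2)) (I • L) ξ :=
      (L.hasFDerivAt.const_mul I).congr_of_eventuallyEq
        (Filter.Eventually.of_forall fun ζ => by simp only [hL])
    exact h1.cexp
  have hgd : ∀ ξ, HasFDerivAt (fun ζ => g (ζ, wOf x))
      ((fderiv ℝ g (ξ, wOf x)).comp (ContinuousLinearMap.inl ℝ ℂ ℂ)) ξ := fun ξ =>
    ((hg.contDiff.differentiable (by simp)) (ξ, wOf x)).hasFDerivAt.comp ξ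
      (hasFDerivAt_prodMk_left ξ (wOf x))
  have hfe : ∀ ξ, fderiv ℝ e ξ v = I * (v.re * x 0 + v.im * x 2) * e ξ := by
    intro ξ
    rw [(hed ξ).fderiv]
    simp [hL]
    ring
  have hfg : ∀ ξ, fderiv ℝ (fun ζ => g (ζ, wOf x)) ξ v = fderiv ℝ g (ξ, wOf x) (v, 0) := by
    intro ξ
    rw [(hgd ξ).fderiv]
    simp
  have hparts := integral_mul_fderiv_eq_neg_fderiv_mul_of_integrable (𝕜 := ℂ)
    (μ := (volume : Measure ℂ)) (f := e) (g := fun ζ => g (ζ, wOf x)) (v := v)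
    (by simp only [hfe]; exact hg.integrable_mul (continuous_const.mul hec) _)
    (by simp only [hfg]; exact (hg.fderiv_apply (v, 0)).integrable_mul hec _)
    (hg.integrable_mul hec _)
    (fun ξ _ => (hed ξ).differentiableAt) (fun ξ _ => (hgd ξ).differentiableAt)
  simp only [hfe, hfg, mul_assoc] at hparts
  simp only [invFourier]
  simp only [he] at hparts
  rw [hparts]
  simp only [integral_const_mul]
  ring

open FourierTransform in
theorem Fz_ofCoords_invFourier {g : ℂ × ℂ → ℂ} (hg : IsTest g) (ξ w : ℂ) :
    Fz (ofCoords (invFourier g)) (ξ, w) = g (ξ, w) := by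
  set h : ℂ → ℂ := fun ζ => g (ζ, w)
  let φ : SchwartzMap ℂ ℂ :=
    (hg.slice_hasCompactSupport w).toSchwartzMap (hg.slice_contDiff w)
  have hφ : (φ : ℂ → ℂ) = h := rfl
  have hinv : 𝓕 (𝓕⁻ h) ξ = h ξ := by
    rw [← hφ, ← SchwartzMap.fourierInv_coe, ← SchwartzMap.fourier_coe,
      FourierTransform.fourier_fourierInv_eq]
  have hk : ∀ z : ℂ, ofCoords (invFourier g) (z, w) =
      (1 / (2 * Real.pi) : ℂ) * 𝓕⁻ h ((2 * Real.pi)⁻¹ • z) := by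
    intro z
    rw [Real.fourierInv_eq']
    simp only [ofCoords, invFourier]
    congr 2
    funext ζ
    rw [smul_eq_mul]
    congr 2
    · rw [real_inner_smul_right, Complex.inner]
      have : (Real.pi : ℂ) ≠ 0 := by exact_mod_cast Real.pi_ne_zero
      simp
      field_simp
    · simp [wOf, mul_comm I]
  simp only [Fz]
  rw [integral_prod_eq_integral_complex
    (fun z => cexp (-(I * (((ξ * (starRingEnd ℂ) z).re : ℝ) : ℂ))) *
      ofCoords (invFourier g) (z, w))]
  have hrw : (fun z => cexp (-(I * (((ξ * (starRingEnd ℂ) z).re : ℝ) : ℂ))) *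
      ofCoords (invFourier g) (z, w)) = fun z => (1 / (2 * Real.pi) : ℂ) *
        (fun y : ℂ => cexp (↑(-2 * Real.pi * inner ℝ y ξ) * I) • 𝓕⁻ h y)
          ((2 * Real.pi)⁻¹ • z) := by
    funext z
    rw [hk]
    simp only [smul_eq_mul]
    rw [real_inner_smul_left, Complex.inner, mul_left_comm]
    congr 3
    have : (Real.pi : ℂ) ≠ 0 := by exact_mod_cast Real.pi_ne_zero
    simp
    field_simp
  rw [hrw, integral_const_mul, Measure.integral_comp_inv_smul volume
      (fun y : ℂ => cexp (↑(-2 * Real.pi * inner ℝ y ξ) * I) • 𝓕⁻ h y) (2 * Real.pi),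
    ← Real.fourier_eq', hinv, Complex.finrank_real_complex]
  have : (Real.pi : ℂ) ≠ 0 := by exact_mod_cast Real.pi_ne_zero
  simp [h, abs_of_pos Real.pi_pos]
  field_simp

/-- The right-hand side of the formula for `ℓ̂_A`. -/
def lhatRHS (A : ℂ × ℂ) (f : ℂ × ℂ → ℂ) : ℂ × ℂ → ℂ := fun p =>
  A.1 * ((1 / 2) * wdw f p - wdXibar f p) +
    (starRingEnd ℂ) A.1 * ((1 / 2) * wdwbar f p - wdXi f p) +
    (I / 2) * (A.2 * cexp (p.2 - (starRingEnd ℂ) p.1 / 2) +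
      (starRingEnd ℂ) A.2 * cexp ((starRingEnd ℂ) p.2 - p.1 / 2)) * f p

theorem hasSum_moyal4_affHamC4 (A : ℂ × ℂ) {f : ℂ × ℂ → ℂ} (hf : IsTest f) (x : R4) :
    IsTest (lhatRHS A f) ∧
    HasSum (fun r : ℕ => ((r.factorial : ℂ))⁻¹ * (1 / (2 * I)) ^ r *
      P4 r (fun y => I * affHamC4 A y) (invFourier f) x) (invFourier (lhatRHS A f) x) := by
  obtain ⟨α, β⟩ := A
  set α' := (starRingEnd ℂ) α
  set β' := (starRingEnd ℂ) β
  have hham : (fun y => I * affHamC4 (α, β) y) =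
      hamFamily (I / 2 * α) (I / 2 * α') (I / 2 * β) (I / 2 * β') 0 := by
    funext y
    simp only [affHamC4, hamFamily]
    ring
  have hd : ∀ v : ℂ × ℂ, IsTest fun p => fderiv ℝ f p v := hf.fderiv_apply
  have hs1 : ContDiff ℝ (⊤ : ℕ∞) fun p : ℂ × ℂ => -(I * (starRingEnd ℂ) p.1) :=
    (contDiff_const.mul contDiff_conj_fst).neg
  have hs2 : ContDiff ℝ (⊤ : ℕ∞) fun p : ℂ × ℂ => -(I * p.1) :=
    (contDiff_const.mul contDiff_fst).neg
  have hE1 : IsTest fun p => cexp (1 / (2 * I) * -(I * (starRingEnd ℂ) p.1)) * f p :=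
    hf.smooth_mul (contDiff_const.mul hs1).cexp
  have hE2 : IsTest fun p => cexp (1 / (2 * I) * -(I * p.1)) * f p :=
    hf.smooth_mul (contDiff_const.mul hs2).cexp
  have hE1' := hE1.smooth_mul (φ := fun p => I / 2 * β * cexp p.2)
    (contDiff_const.mul contDiff_snd.cexp)
  have hE2' := hE2.smooth_mul (φ := fun p => I / 2 * β' * cexp ((starRingEnd ℂ) p.2))
    (contDiff_const.mul contDiff_conj_snd.cexp)
  have hT1 := (hd (0, 1)).const_mul ((α + α') / 4)
  have hT2 := (hd (0, I)).const_mul (-(I * (α - α')) / 4)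
  have hT3 := (hd (1, 0)).const_mul (-(α + α') / 2)
  have hT4 := (hd (I, 0)).const_mul (-(I * (α - α')) / 2)
  have hH : lhatRHS (α, β) f = fun p =>
      (I / 2 * β * cexp p.2 * (cexp (1 / (2 * I) * -(I * (starRingEnd ℂ) p.1)) * f p) +
      I / 2 * β' * cexp ((starRingEnd ℂ) p.2) * (cexp (1 / (2 * I) * -(I * p.1)) * f p)) +
      ((-(α + α') / 2 * fderiv ℝ f p (1, 0) + -(I * (α - α')) / 2 * fderiv ℝ f p (I, 0)) +
      ((α + α') / 4 * fderiv ℝ f p (0, 1) + -(I * (α - α')) / 4 * fderiv ℝ f p (0, I))) := by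
    funext p
    have hc : ∀ y : ℂ, 1 / (2 * I) * -(I * y) = -(y / 2) := fun y => by
      field_simp
    simp only [lhatRHS, wdw, wdwbar, wdXi, wdXibar, hc, sub_eq_add_neg, Complex.exp_add]
    ring
  have hHtest : IsTest (lhatRHS (α, β) f) := by
    rw [hH]
    exact (hE1'.add hE2').add ((hT3.add hT4).add (hT1.add hT2))
  refine ⟨hHtest, ?_⟩
  have hval : invFourier (lhatRHS (α, β) f) x =
      (I / 2 * β * cexp (wOf x) *
          invFourier (fun p => cexp (1 / (2 * I) * -(I * (starRingEnd ℂ) p.1)) * f p) x +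
        I / 2 * β' * cexp ((starRingEnd ℂ) (wOf x)) *
          invFourier (fun p => cexp (1 / (2 * I) * -(I * p.1)) * f p) x) +
        ((I / 2 * α * zOf x + I / 2 * α' * (starRingEnd ℂ) (zOf x)) * invFourier f x +
        1 / (2 * I) * ((I / 2 * α + I / 2 * α') * invFourier (symbolOp 1 f) x -
          I * (I / 2 * α - I / 2 * α') * invFourier (symbolOp 3 f) x)) := by
    rw [hH, invFourier_add (hE1'.add hE2') ((hT3.add hT4).add (hT1.add hT2)),
      invFourier_add hE1' hE2', invFourier_add (hT3.add hT4) (hT1.add hT2),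
      invFourier_add hT3 hT4, invFourier_add hT1 hT2,
      invFourier_mul_snd (fun w => I / 2 * β * cexp w),
      invFourier_mul_snd (fun w => I / 2 * β' * cexp ((starRingEnd ℂ) w))]
    simp only [invFourier_const_mul, invFourier_fderiv_fst hf, symbolOp_one, symbolOp_three]
    congr 2
    · simp [zOf]
      ring
    · field_simp
      ring
  rw [hham, hval]
  simp only [P4_hamFamily_invFourier _ hf]
  have h1 := (hasSum_invFourier_exp hf hs1 (1 / (2 * I)) x).mul_left
    (I / 2 * β * cexp (wOf x))
  have h2 := (hasSum_invFourier_exp hf hs2 (1 / (2 * I)) x).mul_left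
    (I / 2 * β' * cexp ((starRingEnd ℂ) (wOf x)))
  have h3 := hasSum_ite_eq (0 : ℕ)
    ((I / 2 * α * zOf x + I / 2 * α' * (starRingEnd ℂ) (zOf x)) * invFourier f x)
  have h4 := hasSum_ite_eq (1 : ℕ)
    (1 / (2 * I) * ((I / 2 * α + I / 2 * α') * invFourier (symbolOp 1 f) x -
          I * (I / 2 * α - I / 2 * α') * invFourier (symbolOp 3 f) x))
  refine ((h1.add h2).add (h3.add h4)).congr_fun ?_
  intro r
  by_cases hr0 : r = 0
  · subst hr0
    simp
  · by_cases hr1 : r = 1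
    · subst hr1
      simp
      ring
    · simp [hr0, hr1]
      ring

/-- For `A = (α,β) ∈ aff(ℂ)` and `ℓ_A(g) = iÃ ⋆ g` the left Moyal multiplication
by `iÃ`: for every compactly supported smooth `f` on `ℂ × H_k`, the Moyal series
defining `ℓ_A(F_z⁻¹(f))` converges, and `ℓ̂_A := F_z ∘ ℓ_A ∘ F_z⁻¹` satisfies
`ℓ̂_A(f) = α((1/2)∂_w - ∂_ξ̄)f + ᾱ((1/2)∂_w̄ - ∂_ξ)f
          + (i/2)(βe^{w - ξ̄/2} + β̄e^{w̄ - ξ/2})f`. -/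
theorem lhat_affC (k : ℤ) (A : ℂ × ℂ) (f : ℂ × ℂ → ℂ)
    (hsmooth : ContDiff ℝ (⊤ : ℕ∞) f) (hsupp : HasCompactSupport f)
    (hstrip : ∀ z w : ℂ, f (z, w) ≠ 0 → w ∈ stripH k) :
    (∀ x : R4,
      Summable (fun r : ℕ => ((r.factorial : ℂ))⁻¹ * (1 / (2 * I)) ^ r *
        P4 r (fun y => I * affHamC4 A y) (toCoords (FzInv f)) x)) ∧
    (∀ ξ w : ℂ,
      Fz (ofCoords (moyal4 (fun y => I * affHamC4 A y) (toCoords (FzInv f)))) (ξ, w) =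
        A.1 * ((1 / 2) * wdw f (ξ, w) - wdXibar f (ξ, w)) +
          (starRingEnd ℂ) A.1 * ((1 / 2) * wdwbar f (ξ, w) - wdXi f (ξ, w)) +
          (I / 2) * (A.2 * Complex.exp (w - (starRingEnd ℂ) ξ / 2) +
            (starRingEnd ℂ) A.2 * Complex.exp ((starRingEnd ℂ) w - ξ / 2)) *
            f (ξ, w)) := by
  have hf : IsTest f := ⟨hsmooth, hsupp⟩
  rw [toCoords_FzInv]
  refine ⟨fun x => (hasSum_moyal4_affHamC4 A hf x).2.summable, fun ξ w => ?_⟩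
  have hmoyal : moyal4 (fun y => I * affHamC4 A y) (invFourier f) = invFourier (lhatRHS A f) :=
    funext fun x => (hasSum_moyal4_affHamC4 A hf x).2.tsum_eq
  rw [hmoyal, Fz_ofCoords_invFourier (hasSum_moyal4_affHamC4 A hf 0).1]
  rfl

end
end
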